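/- Fix T > 0, d, m ∈ ℕ, C ≥ 0, a continuous map a : ℝ × EuclideanSpace ℝ (Fin d) → EuclideanSpace ℝ (Fin d) satisfying the linear growth bound ‖a(t,x)‖² ≤ C * (1 + ‖x‖²) for all t ∈ [0,T] and all x, a continuous linear map b : EuclideanSpace ℝ (Fin m) → EuclideanSpace ℝ (Fin d), a continuous path B : ℝ → EuclideanSpace ℝ (Fin m), and x0 ∈ EuclideanSpace ℝ (Fin d). Let M = sup over s ∈ [0,T] of ‖B s - B 0‖. If X is continuous on [0,T] and satisfies X t = x0 + ∫_0^t a(s, X s) ds + b (B t - B 0) for all t ∈ [0,T], then for every t ∈ [0,T], ‖X t‖ ≤ (‖x0‖ + √C * T + ‖b‖ * M) * exp(√C * t). -/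

import Mathlib

open Real intervalIntegral

/-- Integral form of Grönwall's inequality with constant coefficients. -/
theorem le_mul_exp_of_le_add_mul_integral {u : ℝ → ℝ} {T A k : ℝ} (hk : 0 ≤ k)
    (hu : ContinuousOn u (Set.Icc 0 T))
    (h : ∀ t ∈ Set.Icc (0 : ℝ) T, u t ≤ A + k * ∫ s in (0 : ℝ)..t, u s) :
    ∀ t ∈ Set.Icc (0 : ℝ) T, u t ≤ A * Real.exp (k * t) := by
  intro t ht
  have hT : 0 ≤ T := ht.1.trans ht.2
  set w : ℝ → ℝ := Set.IccExtend hT ((Set.Icc 0 T).domRestrict u)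
  have hw : Continuous w := hu.domRestrict.Icc_extend'
  have hwu : ∀ s ∈ Set.Icc (0 : ℝ) T, w s = u s := fun s hs => Set.IccExtend_of_mem hT _ hs
  have hint : ∀ s ∈ Set.Icc (0 : ℝ) T, ∫ r in (0 : ℝ)..s, w r = ∫ r in (0 : ℝ)..s, u r := by
    intro s hs
    refine intervalIntegral.integral_congr fun r hr => hwu r ?_
    rw [Set.uIcc_of_le hs.1] at hr
    exact ⟨hr.1, hr.2.trans hs.2⟩
  set v : ℝ → ℝ := fun s => A + k * ∫ r in (0 : ℝ)..s, w r
  have huv : ∀ s ∈ Set.Icc (0 : ℝ) T, u s ≤ v s := fun s hs => by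
    simpa only [v, hint s hs] using h s hs
  have hv : ∀ s, HasDerivAt v (k * w s) s := fun s =>
    ((hw.integral_hasStrictDerivAt 0 s).hasDerivAt.const_mul k).const_add A
  have hg := le_gronwallBound_of_liminf_deriv_right_le (f := v) (f' := fun s => k * w s)
    (δ := A) (K := k) (ε := 0) (a := 0) (b := T)
    (fun s _ => (hv s).continuousAt.continuousWithinAt)
    (fun s _ _ hr => (hv s).hasDerivWithinAt.liminf_right_slope_le hr)
    (by simp [v])
    (fun s hs => by
      have hs' := Set.Ico_subset_Icc_self hs
      simpa [hwu s hs'] using mul_le_mul_of_nonneg_left (huv s hs') hk)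
    t ht
  rw [gronwallBound_ε0, sub_zero] at hg
  exact (huv t ht).trans hg

theorem le_sqrt_mul_one_add_of_sq_le {y x C : ℝ} (hx : 0 ≤ x) (hC : 0 ≤ C)
    (h : y ^ 2 ≤ C * (1 + x ^ 2)) : y ≤ Real.sqrt C * (1 + x) := by
  refine abs_le_of_sq_le_sq' ?_ (by positivity) |>.2
  rw [mul_pow, Real.sq_sqrt hC]
  exact h.trans (mul_le_mul_of_nonneg_left (by nlinarith) hC)

/-- A priori bound for solutions of the additive-noise SDE `dX_t = a(t, X_t) dt + b dB_t`
under the linear growth condition `‖a(t,x)‖² ≤ C (1 + ‖x‖²)`: with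
`M = sup_{s ∈ [0,T]} ‖B s - B 0‖`, every continuous solution satisfies
`‖X t‖ ≤ (‖x0‖ + √C T + ‖b‖ M) exp(√C t)` on `[0,T]`. -/
theorem sde_linear_growth_bound
    (T : ℝ) (hT : 0 < T) (d m : ℕ) (C : ℝ) (hC : 0 ≤ C)
    (a : ℝ × EuclideanSpace ℝ (Fin d) → EuclideanSpace ℝ (Fin d)) (ha : Continuous a)
    (haC : ∀ t ∈ Set.Icc (0:ℝ) T, ∀ x : EuclideanSpace ℝ (Fin d),
      ‖a (t, x)‖ ^ 2 ≤ C * (1 + ‖x‖ ^ 2))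
    (b : EuclideanSpace ℝ (Fin m) →L[ℝ] EuclideanSpace ℝ (Fin d))
    (B : ℝ → EuclideanSpace ℝ (Fin m)) (hB : Continuous B)
    (x0 : EuclideanSpace ℝ (Fin d))
    (M : ℝ) (hM : M = sSup ((fun s => ‖B s - B 0‖) '' Set.Icc (0:ℝ) T))
    (X : ℝ → EuclideanSpace ℝ (Fin d)) (hXc : ContinuousOn X (Set.Icc 0 T))
    (hX : ∀ t ∈ Set.Icc (0:ℝ) T,
      X t = x0 + (∫ s in (0:ℝ)..t, a (s, X s)) + b (B t - B 0)) :
    ∀ t ∈ Set.Icc (0:ℝ) T,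
      ‖X t‖ ≤ (‖x0‖ + Real.sqrt C * T + ‖b‖ * M) * Real.exp (Real.sqrt C * t) := by
  subst hM
  refine le_mul_exp_of_le_add_mul_integral (Real.sqrt_nonneg C) hXc.norm fun t ht => ?_
  have hsub : Set.uIcc 0 t ⊆ Set.Icc 0 T := by
    rw [Set.uIcc_of_le ht.1]
    exact Set.Icc_subset_Icc_right ht.2
  have hXt : IntervalIntegrable (fun s => ‖X s‖) MeasureTheory.volume 0 t :=
    (hXc.norm.mono hsub).intervalIntegrable
  have hdrift : ‖∫ s in (0:ℝ)..t, a (s, X s)‖ ≤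
      Real.sqrt C * T + Real.sqrt C * ∫ s in (0:ℝ)..t, ‖X s‖ := by
    calc ‖∫ s in (0:ℝ)..t, a (s, X s)‖
        ≤ ∫ s in (0:ℝ)..t, Real.sqrt C * (1 + ‖X s‖) := by
          refine intervalIntegral.norm_integral_le_of_norm_le ht.1
            (Filter.Eventually.of_forall fun s hs => ?_)
            ((intervalIntegrable_const.add hXt).const_mul _)
          exact le_sqrt_mul_one_add_of_sq_le (norm_nonneg _) hC
            (haC s ⟨hs.1.le, hs.2.trans ht.2⟩ _)
      _ = Real.sqrt C * t + Real.sqrt C * ∫ s in (0:ℝ)..t, ‖X s‖ := by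
          rw [intervalIntegral.integral_const_mul,
            intervalIntegral.integral_add intervalIntegrable_const hXt]
          simp [mul_add]
      _ ≤ _ := by
          gcongr
          exact ht.2
  have hnoise : ‖b (B t - B 0)‖ ≤
      ‖b‖ * sSup ((fun s => ‖B s - B 0‖) '' Set.Icc (0:ℝ) T) := by
    refine b.le_opNorm_of_le (le_csSup ?_ (Set.mem_image_of_mem _ ht))
    exact isCompact_Icc.bddAbove_image (by fun_prop)
  calc ‖X t‖ ≤ ‖x0‖ + ‖∫ s in (0:ℝ)..t, a (s, X s)‖ + ‖b (B t - B 0)‖ := by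
        rw [hX t ht]
        exact norm_add₃_le
    _ ≤ _ := by linarith
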